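/- arXiv:hep-th/9806101 — 2 statements merged into one kernel-verified Lean document; each statement's English description precedes it below -/
import Mathlib

section
/- For every C² map Ψ : ℝ^{n+2} → A and every y ∈ ℝ^{n+2}: −(1/2) Σ_{a,b=0}^{n+1} η_{aa} η_{bb} M_{ab}(M_{ab}Ψ)(y) = −y²·(∂²Ψ)(y) + δ(δΨ)(y) + (n+1)(δΨ)(y) + ((n+1)(n+2)/8)·Ψ(y) − (y̸(∂̸Ψ))(y), where M_{ab} = L_{ab} + S_{ab}. (The quadratic Casimir acting on spinor fields equals −y²∂² + δ(δ + n + 1) + (n+1)(n+2)/8 − y̸∂̸.) -/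
open Finset

/-- The diagonal metric of signature `(2,n)` on `ℝ^{n+2}`. -/
def eta (n : ℕ) (a : Fin (n + 2)) : ℝ := if (a : ℕ) < 2 then 1 else -1

/-- Partial derivative in the `a`-th coordinate direction (componentwise). -/
noncomputable def pd (n : ℕ) {A : Type*} [NormedRing A] [NormedAlgebra ℝ A]
    (a : Fin (n + 2)) (Ψ : (Fin (n + 2) → ℝ) → A) : (Fin (n + 2) → ℝ) → A :=
  fun y => fderiv ℝ Ψ y (Pi.single a 1)

/-- The Euler operator `δΨ = Σ_a y_a ∂_a Ψ`. -/
noncomputable def euler (n : ℕ) {A : Type*} [NormedRing A] [NormedAlgebra ℝ A]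
    (Ψ : (Fin (n + 2) → ℝ) → A) : (Fin (n + 2) → ℝ) → A :=
  fun y => ∑ a, (y a) • pd n a Ψ y

/-- The quadratic form `y² = Σ_a η_{aa} y_a²` of signature `(2,n)`. -/
def ysq (n : ℕ) (y : Fin (n + 2) → ℝ) : ℝ := ∑ a, eta n a * (y a) ^ 2

/-- The `η`-d'Alembertian `∂²Ψ = Σ_a η_{aa} ∂_a ∂_a Ψ`. -/
noncomputable def box (n : ℕ) {A : Type*} [NormedRing A] [NormedAlgebra ℝ A]
    (Ψ : (Fin (n + 2) → ℝ) → A) : (Fin (n + 2) → ℝ) → A :=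
  fun y => ∑ a, eta n a • pd n a (pd n a Ψ) y

/-- Left Clifford multiplication `y̸Ψ = (Σ_a y_a γ_a)·Ψ`. -/
noncomputable def yslash (n : ℕ) {A : Type*} [NormedRing A] [NormedAlgebra ℝ A]
    (γ : Fin (n + 2) → A) (Ψ : (Fin (n + 2) → ℝ) → A) :
    (Fin (n + 2) → ℝ) → A :=
  fun y => (∑ a, (y a) • γ a) * Ψ y

/-- The Dirac operator `∂̸Ψ = Σ_a η_{aa} γ_a ∂_a Ψ`. -/
noncomputable def dslash (n : ℕ) {A : Type*} [NormedRing A] [NormedAlgebra ℝ A]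
    (γ : Fin (n + 2) → A) (Ψ : (Fin (n + 2) → ℝ) → A) :
    (Fin (n + 2) → ℝ) → A :=
  fun y => ∑ a, eta n a • (γ a * pd n a Ψ y)

/-- The orbital part `L_{ab}Ψ = η_{aa} y_a ∂_b Ψ - η_{bb} y_b ∂_a Ψ`. -/
noncomputable def Lop (n : ℕ) {A : Type*} [NormedRing A] [NormedAlgebra ℝ A]
    (a b : Fin (n + 2)) (Ψ : (Fin (n + 2) → ℝ) → A) :
    (Fin (n + 2) → ℝ) → A :=
  fun y => (eta n a * y a) • pd n b Ψ y - (eta n b * y b) • pd n a Ψ y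

/-- The spin part `S_{ab}Ψ = (1/4)(γ_a γ_b - γ_b γ_a)·Ψ`. -/
noncomputable def Sop (n : ℕ) {A : Type*} [NormedRing A] [NormedAlgebra ℝ A]
    (γ : Fin (n + 2) → A) (a b : Fin (n + 2)) (Ψ : (Fin (n + 2) → ℝ) → A) :
    (Fin (n + 2) → ℝ) → A :=
  fun y => (1 / 4 : ℝ) • ((γ a * γ b - γ b * γ a) * Ψ y)

/-- The total action `M_{ab} = L_{ab} + S_{ab}` of `so(2,n)` on spinor fields. -/
noncomputable def Mop (n : ℕ) {A : Type*} [NormedRing A] [NormedAlgebra ℝ A]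
    (γ : Fin (n + 2) → A) (a b : Fin (n + 2)) (Ψ : (Fin (n + 2) → ℝ) → A) :
    (Fin (n + 2) → ℝ) → A :=
  fun y => Lop n a b Ψ y + Sop n γ a b Ψ y

section

variable {n : ℕ} {A : Type*} [NormedRing A] [NormedAlgebra ℝ A]

theorem eta_eq_one_or_neg_one (a : Fin (n + 2)) : eta n a = 1 ∨ eta n a = -1 := by
  unfold eta
  split_ifs <;> simp

theorem hasFDerivAt_coord (y : Fin (n + 2) → ℝ) (a : Fin (n + 2)) :
    HasFDerivAt (fun y : Fin (n + 2) → ℝ => y a)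
      (ContinuousLinearMap.proj (R := ℝ) (φ := fun _ => ℝ) a) y :=
  hasFDerivAt_apply a y

theorem contDiff_pd {Ψ : (Fin (n + 2) → ℝ) → A} (hΨ : ContDiff ℝ 2 Ψ) (a : Fin (n + 2)) :
    ContDiff ℝ 1 (pd n a Ψ) :=
  (hΨ.fderiv_right (m := 1) (by norm_num)).clm_apply contDiff_const

theorem pd_comm {Ψ : (Fin (n + 2) → ℝ) → A} (hΨ : ContDiff ℝ 2 Ψ) (a b : Fin (n + 2))
    (y : Fin (n + 2) → ℝ) : pd n a (pd n b Ψ) y = pd n b (pd n a Ψ) y := by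
  have hd : DifferentiableAt ℝ (fderiv ℝ Ψ) y :=
    (hΨ.fderiv_right (m := 1) (by norm_num)).differentiable (by norm_num) y
  have hsymm : IsSymmSndFDerivAt ℝ Ψ y := hΨ.contDiffAt.isSymmSndFDerivAt (by simp)
  have key (c d : Fin (n + 2)) : pd n c (pd n d Ψ) y
      = fderiv ℝ (fderiv ℝ Ψ) y (Pi.single c 1) (Pi.single d 1) := by
    unfold pd
    rw [fderiv_clm_apply hd (differentiableAt_const _)]
    simp
  rw [key, key, hsymm.eq]

theorem pd_smul_coord {Φ : (Fin (n + 2) → ℝ) → A} {y : Fin (n + 2) → ℝ}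
    (hΦ : DifferentiableAt ℝ Φ y) (r : ℝ) (a c : Fin (n + 2)) :
    pd n c (fun z => (r * z a) • Φ z) y
      = (r * y a) • pd n c Φ y + (if a = c then r else 0) • Φ y := by
  have h := (((hasFDerivAt_coord y a).const_mul r).smul hΦ.hasFDerivAt).fderiv
  refine (congrArg (fun T => T (Pi.single c 1)) h).trans ?_
  simp [pd, Pi.single_apply]

theorem euler_euler {Ψ : (Fin (n + 2) → ℝ) → A} (hΨ : ContDiff ℝ 2 Ψ)
    (y : Fin (n + 2) → ℝ) :
    euler n (euler n Ψ) y
      = (∑ a, ∑ b, (y a * y b) • pd n a (pd n b Ψ) y) + euler n Ψ y := by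
  have hp (b : Fin (n + 2)) : DifferentiableAt ℝ (pd n b Ψ) y :=
    (contDiff_pd hΨ b).differentiable (by norm_num) y
  have key (a : Fin (n + 2)) :
      pd n a (euler n Ψ) y = (∑ b, y b • pd n a (pd n b Ψ) y) + pd n a Ψ y := by
    have hsum : pd n a (euler n Ψ) y = ∑ b, pd n a (fun z => (1 * z b) • pd n b Ψ z) y := by
      simp only [one_mul]
      have h := fderiv_fun_sum (u := Finset.univ) (A := fun b z => z b • pd n b Ψ z)
        fun b _ => (hasFDerivAt_coord y b).differentiableAt.smul (hp b)
      refine (congrArg (fun T => T (Pi.single a 1)) h).trans ?_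
      simp [pd]
    rw [hsum]
    simp_rw [pd_smul_coord (hp _)]
    simp [Finset.sum_add_distrib, ite_smul]
  conv_lhs => unfold euler
  change ∑ a, y a • pd n a (euler n Ψ) y = _
  simp_rw [key, smul_add, Finset.sum_add_distrib, Finset.smul_sum, smul_smul]
  rfl

theorem pd_Mop {Ψ : (Fin (n + 2) → ℝ) → A} (hΨ : ContDiff ℝ 2 Ψ) (γ : Fin (n + 2) → A)
    (a b c : Fin (n + 2)) (y : Fin (n + 2) → ℝ) :
    pd n c (Mop n γ a b Ψ) y
      = ((eta n a * y a) • pd n c (pd n b Ψ) y + (if a = c then eta n a else 0) • pd n b Ψ y)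
        - ((eta n b * y b) • pd n c (pd n a Ψ) y + (if b = c then eta n b else 0) • pd n a Ψ y)
        + (1 / 4 : ℝ) • ((γ a * γ b - γ b * γ a) * pd n c Ψ y) := by
  have hp (b : Fin (n + 2)) : DifferentiableAt ℝ (pd n b Ψ) y :=
    (contDiff_pd hΨ b).differentiable (by norm_num) y
  have hΨd : DifferentiableAt ℝ Ψ y := hΨ.differentiable (by norm_num) y
  have hL (r : ℝ) (a b : Fin (n + 2)) :
      DifferentiableAt ℝ (fun z : Fin (n + 2) → ℝ => (r * z a) • pd n b Ψ z) y :=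
    ((hasFDerivAt_coord y a).const_mul r).differentiableAt.smul (hp b)
  rw [← pd_smul_coord (hp b), ← pd_smul_coord (hp a)]
  unfold Mop Lop Sop
  have h := (((hL (eta n a) a b).hasFDerivAt.sub (hL (eta n b) b a).hasFDerivAt).add
    ((hΨd.hasFDerivAt.const_mul (γ a * γ b - γ b * γ a)).const_smul (1 / 4 : ℝ))).fderiv
  refine (congrArg (fun T => T (Pi.single c 1)) h).trans ?_
  simp [pd]

/-- The part of `∑ η_{aa} η_{bb} M_{ab} M_{ab}` attributed to the ordered pair `(a, b)`. -/
noncomputable def casimirTerm (γ : Fin (n + 2) → A) (Ψ : (Fin (n + 2) → ℝ) → A)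
    (y : Fin (n + 2) → ℝ) (a b : Fin (n + 2)) : A :=
  (eta n a * y a ^ 2) • eta n b • pd n b (pd n b Ψ) y - (y a * y b) • pd n a (pd n b Ψ) y
    - y a • pd n a Ψ y - ((1 / 8 : ℝ) - if a = b then 1 / 8 else 0) • Ψ y
    + (y a • γ a) * (eta n b • (γ b * pd n b Ψ y))

theorem smul_Mop_Mop {γ : Fin (n + 2) → A}
    (hγ : ∀ a b, γ a * γ b + γ b * γ a
      = ((2 : ℝ) * (if a = b then eta n a else 0)) • (1 : A))
    {Ψ : (Fin (n + 2) → ℝ) → A} (hΨ : ContDiff ℝ 2 Ψ) (y : Fin (n + 2) → ℝ)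
    (a b : Fin (n + 2)) :
    (eta n a * eta n b) • Mop n γ a b (Mop n γ a b Ψ) y
      = casimirTerm γ Ψ y a b + casimirTerm γ Ψ y b a := by
  have hsq (c : Fin (n + 2)) : γ c * γ c = eta n c • (1 : A) := by
    have h := hγ c c
    rw [if_pos rfl, ← two_smul ℝ, mul_smul] at h
    exact smul_right_injective A (two_ne_zero (α := ℝ)) h
  by_cases hab : a = b
  · subst hab
    have hM (Φ : (Fin (n + 2) → ℝ) → A) : Mop n γ a a Φ y = 0 := by simp [Mop, Lop, Sop]
    have hsq' (X : A) : γ a * (γ a * X) = eta n a • X := by rw [← mul_assoc, hsq]; simp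
    rw [hM]
    simp only [casimirTerm, if_true, smul_mul_assoc, mul_smul_comm, hsq']
    rcases eta_eq_one_or_neg_one a with h | h <;> rw [h] <;> module
  · have hanti : γ b * γ a = -(γ a * γ b) := by
      have h := hγ a b
      rw [if_neg hab, mul_zero, zero_smul] at h
      exact eq_neg_of_add_eq_zero_right h
    have hX : (γ a * γ b) * (γ a * γ b) = -((eta n a * eta n b) • (1 : A)) := by
      calc (γ a * γ b) * (γ a * γ b) = γ a * (γ b * γ a) * γ b := by noncomm_ring
        _ = -((γ a * γ a) * (γ b * γ b)) := by rw [hanti]; noncomm_ring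
        _ = _ := by simp [hsq, smul_smul, mul_comm]
    have hXX (Z : A) : (γ a * γ b) * ((γ a * γ b) * Z) = -((eta n a * eta n b) • Z) := by
      rw [← mul_assoc, hX]; simp
    have hab' : b ≠ a := Ne.symm hab
    have hexp : Mop n γ a b (Mop n γ a b Ψ) y
        = (eta n a * y a) • pd n b (Mop n γ a b Ψ) y
          - (eta n b * y b) • pd n a (Mop n γ a b Ψ) y
          + (1 / 4 : ℝ) • ((γ a * γ b - γ b * γ a) * ((eta n a * y a) • pd n b Ψ y
            - (eta n b * y b) • pd n a Ψ y
            + (1 / 4 : ℝ) • ((γ a * γ b - γ b * γ a) * Ψ y))) := rfl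
    have hcomm : γ a * γ b - γ b * γ a = (2 : ℝ) • (γ a * γ b) := by rw [hanti]; module
    rw [hexp, pd_Mop hΨ, pd_Mop hΨ, hcomm, pd_comm hΨ b a]
    simp only [casimirTerm, if_neg hab, if_neg hab', if_true, smul_mul_assoc, mul_smul_comm,
      mul_add, mul_sub, hXX, ← mul_assoc (γ a) (γ b), ← mul_assoc (γ b) (γ a), hanti, neg_mul,
      pd_comm hΨ b a]
    rcases eta_eq_one_or_neg_one a with h | h <;> rcases eta_eq_one_or_neg_one b with h' | h' <;>
      rw [h, h'] <;> module

theorem sum_casimirTerm (γ : Fin (n + 2) → A) {Ψ : (Fin (n + 2) → ℝ) → A}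
    (hΨ : ContDiff ℝ 2 Ψ) (y : Fin (n + 2) → ℝ) :
    ∑ a, ∑ b, casimirTerm γ Ψ y a b
      = ysq n y • box n Ψ y - euler n (euler n Ψ) y - ((n : ℝ) + 1) • euler n Ψ y
        - (((n : ℝ) + 1) * ((n : ℝ) + 2) / 8) • Ψ y + yslash n γ (dslash n γ Ψ) y := by
  have h1 : ∑ a, ∑ b, (eta n a * y a ^ 2) • eta n b • pd n b (pd n b Ψ) y
      = ysq n y • box n Ψ y := by
    simp only [ysq, _root_.box, Finset.sum_smul, Finset.smul_sum]
    exact Finset.sum_comm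
  have h2 : ∑ a, ∑ _b : Fin (n + 2), y a • pd n a Ψ y = ((n : ℝ) + 2) • euler n Ψ y := by
    simp only [euler, Finset.sum_const, Finset.card_univ, Fintype.card_fin, Finset.smul_sum,
      ← Nat.cast_smul_eq_nsmul ℝ]
    push_cast
    rfl
  have h3 : ∑ a : Fin (n + 2), ∑ b, ((1 / 8 : ℝ) - if a = b then 1 / 8 else 0) • Ψ y
      = (((n : ℝ) + 1) * ((n : ℝ) + 2) / 8) • Ψ y := by
    simp only [← Finset.sum_smul, Finset.sum_sub_distrib, Finset.sum_ite_eq, Finset.sum_const,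
      Finset.card_univ, Fintype.card_fin, Finset.mem_univ, if_true, nsmul_eq_mul]
    congr 1
    push_cast
    ring
  have h4 : ∑ a, ∑ b, (y a • γ a) * (eta n b • (γ b * pd n b Ψ y))
      = yslash n γ (dslash n γ Ψ) y := by
    simp only [yslash, dslash, Finset.sum_mul_sum]
  simp only [casimirTerm, Finset.sum_add_distrib, Finset.sum_sub_distrib]
  rw [h1, h2, h3, h4, euler_euler hΨ]
  module

end

/-- The quadratic Casimir of `so(2,n)` acting on spinor fields equals
`-y²∂² + δ(δ + n + 1) + (n+1)(n+2)/8 - y̸∂̸`. -/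
theorem casimir_spinor (n : ℕ) (hn : 2 ≤ n)
    (A : Type*) [NormedRing A] [NormedAlgebra ℝ A] [FiniteDimensional ℝ A]
    (γ : Fin (n + 2) → A)
    (hγ : ∀ a b, γ a * γ b + γ b * γ a
      = ((2 : ℝ) * (if a = b then eta n a else 0)) • (1 : A))
    (Ψ : (Fin (n + 2) → ℝ) → A) (hΨ : ContDiff ℝ 2 Ψ)
    (y : Fin (n + 2) → ℝ) :
    (-(1 / 2) : ℝ) • ∑ a, ∑ b, (eta n a * eta n b) • Mop n γ a b (Mop n γ a b Ψ) y
      = (-(ysq n y)) • box n Ψ y + euler n (euler n Ψ) y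
        + ((n : ℝ) + 1) • euler n Ψ y
        + (((n : ℝ) + 1) * ((n : ℝ) + 2) / 8) • Ψ y
        - yslash n γ (dslash n γ Ψ) y := by
  simp_rw [smul_Mop_Mop hγ hΨ, Finset.sum_add_distrib]
  rw [Finset.sum_comm (f := fun a b => casimirTerm γ Ψ y b a), sum_casimirTerm γ hΨ]
  module
end

section
/- Let E₀ ∈ ℝ and let Ψ : ℝ^{n+2} → A be a C² map satisfying ∂²Ψ = 0 and δΨ = −(E₀ + 1/2)·Ψ. Then (y̸∂̸)((y̸∂̸)Ψ) = (n − 1 − 2E₀)·(y̸∂̸)Ψ. Consequently, writing ε = E₀ − (n−1)/2, if ε ≠ 0 then the operator (−2ε)^{−1} y̸∂̸ acts idempotently on such Ψ (item 4 of the Lemma on the properties of y̸ and ∂̸: it is a projector onto an irreducible component of the tensor product decomposition). -/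
open Finset

section PartialDerivatives

variable {n : ℕ} {A : Type*} [NormedRing A] [NormedAlgebra ℝ A]

theorem eta_mul_self (n : ℕ) (a : Fin (n + 2)) : eta n a * eta n a = 1 := by
  unfold eta
  split_ifs <;> norm_num

theorem pd_sum {ι : Type*} (s : Finset ι) {f : ι → (Fin (n + 2) → ℝ) → A}
    {y : Fin (n + 2) → ℝ} (hf : ∀ i ∈ s, DifferentiableAt ℝ (f i) y) (a : Fin (n + 2)) :
    pd n a (fun z => ∑ i ∈ s, f i z) y = ∑ i ∈ s, pd n a (f i) y := by
  simp only [pd]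
  rw [fderiv_fun_sum hf, _root_.sum_apply]

theorem pd_const_smul {f : (Fin (n + 2) → ℝ) → A} {y : Fin (n + 2) → ℝ}
    (hf : DifferentiableAt ℝ f y) (c : ℝ) (a : Fin (n + 2)) :
    pd n a (fun z => c • f z) y = c • pd n a f y := by
  simp only [pd]
  rw [fderiv_fun_const_smul hf]
  rfl

theorem pd_const_mul {f : (Fin (n + 2) → ℝ) → A} {y : Fin (n + 2) → ℝ}
    (hf : DifferentiableAt ℝ f y) (c : A) (a : Fin (n + 2)) :
    pd n a (fun z => c * f z) y = c * pd n a f y := by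
  simp only [pd]
  rw [fderiv_const_mul hf]
  rfl

theorem pd_coord_smul {f : (Fin (n + 2) → ℝ) → A} {y : Fin (n + 2) → ℝ}
    (hf : DifferentiableAt ℝ f y) (a b : Fin (n + 2)) :
    pd n b (fun z => z a • f z) y = y a • pd n b f y + (if a = b then f y else 0) := by
  have hproj : HasFDerivAt (fun z : Fin (n + 2) → ℝ => z a)
      (ContinuousLinearMap.proj a : (Fin (n + 2) → ℝ) →L[ℝ] ℝ) y :=
    (ContinuousLinearMap.proj a : (Fin (n + 2) → ℝ) →L[ℝ] ℝ).hasFDerivAt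
  simp only [pd]
  rw [(hproj.fun_smul hf.hasFDerivAt).fderiv]
  simp [Pi.single_apply]

end PartialDerivatives

section DiracOperator

variable {n : ℕ} {A : Type*} [NormedRing A] [NormedAlgebra ℝ A]

theorem contDiff_dslash (γ : Fin (n + 2) → A) {Ψ : (Fin (n + 2) → ℝ) → A}
    (hΨ : ContDiff ℝ 2 Ψ) : ContDiff ℝ 1 (dslash n γ Ψ) :=
  ContDiff.sum fun a _ => (contDiff_const.mul (contDiff_pd hΨ a)).const_smul (eta n a)

theorem pd_dslash (γ : Fin (n + 2) → A) {Ψ : (Fin (n + 2) → ℝ) → A}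
    (hΨ : ContDiff ℝ 2 Ψ) (a : Fin (n + 2)) (y : Fin (n + 2) → ℝ) :
    pd n a (dslash n γ Ψ) y = ∑ b, eta n b • (γ b * pd n a (pd n b Ψ) y) := by
  have hd (b : Fin (n + 2)) : DifferentiableAt ℝ (pd n b Ψ) y :=
    (contDiff_pd hΨ b).differentiable (by norm_num) y
  unfold dslash
  rw [pd_sum _ fun b _ => ((hd b).const_mul (γ b)).fun_const_smul (eta n b)]
  refine sum_congr rfl fun b _ => ?_
  rw [pd_const_smul ((hd b).const_mul (γ b)), pd_const_mul (hd b)]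

theorem dslash_const_smul (γ : Fin (n + 2) → A) {f : (Fin (n + 2) → ℝ) → A}
    {y : Fin (n + 2) → ℝ} (hf : DifferentiableAt ℝ f y) (c : ℝ) :
    dslash n γ (fun z => c • f z) y = c • dslash n γ f y := by
  simp only [dslash, pd_const_smul hf, mul_smul_comm, smul_sum]
  exact sum_congr rfl fun a _ => smul_comm _ _ _

theorem differentiable_yslash (γ : Fin (n + 2) → A) {f : (Fin (n + 2) → ℝ) → A}
    (hf : Differentiable ℝ f) : Differentiable ℝ (yslash n γ f) := by
  unfold yslash
  fun_prop

/-- Differentiating an eigenfunction of the Euler operator lowers its degree by one. -/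
theorem euler_pd {Ψ : (Fin (n + 2) → ℝ) → A} (hΨ : ContDiff ℝ 2 Ψ) {c : ℝ}
    (hhom : ∀ y, euler n Ψ y = c • Ψ y) (b : Fin (n + 2)) (y : Fin (n + 2) → ℝ) :
    euler n (pd n b Ψ) y = (c - 1) • pd n b Ψ y := by
  have hd (a : Fin (n + 2)) : DifferentiableAt ℝ (pd n a Ψ) y :=
    (contDiff_pd hΨ a).differentiable (by norm_num) y
  have hcoord (a : Fin (n + 2)) : DifferentiableAt ℝ (fun z : Fin (n + 2) → ℝ => z a) y := by
    fun_prop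
  have h : pd n b (euler n Ψ) y = c • pd n b Ψ y := by
    rw [funext hhom, pd_const_smul (hΨ.differentiable (by norm_num) y)]
  unfold euler at h
  rw [pd_sum _ fun a _ => (hcoord a).fun_smul (hd a)] at h
  simp only [pd_coord_smul (hd _), sum_add_distrib, sum_ite_eq', mem_univ, if_true] at h
  simp only [euler, pd_comm hΨ _ b]
  rw [sub_smul, one_smul, ← h, add_sub_cancel_right]

theorem euler_dslash (γ : Fin (n + 2) → A) {Ψ : (Fin (n + 2) → ℝ) → A}
    (hΨ : ContDiff ℝ 2 Ψ) {c : ℝ} (hhom : ∀ y, euler n Ψ y = c • Ψ y)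
    (y : Fin (n + 2) → ℝ) : euler n (dslash n γ Ψ) y = (c - 1) • dslash n γ Ψ y := by
  simp only [euler, pd_dslash γ hΨ, smul_sum]
  rw [sum_comm]
  simp only [dslash, smul_sum]
  refine sum_congr rfl fun b _ => ?_
  rw [smul_comm (c - 1), ← mul_smul_comm (c - 1), ← euler_pd hΨ hhom b y, euler, mul_sum, smul_sum]
  refine sum_congr rfl fun a _ => ?_
  rw [smul_comm (y a), mul_smul_comm]

/-- The square of the Dirac operator is the d'Alembertian. -/
theorem dslash_dslash {γ : Fin (n + 2) → A}
    (hγ : ∀ a b, γ a * γ b + γ b * γ a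
      = ((2 : ℝ) * (if a = b then eta n a else 0)) • (1 : A))
    {Ψ : (Fin (n + 2) → ℝ) → A} (hΨ : ContDiff ℝ 2 Ψ) (y : Fin (n + 2) → ℝ) :
    dslash n γ (dslash n γ Ψ) y = box n Ψ y := by
  have hexp : dslash n γ (dslash n γ Ψ) y =
      ∑ a, ∑ b, (eta n a * eta n b) • (γ a * γ b * pd n a (pd n b Ψ) y) := by
    rw [dslash]
    simp only [pd_dslash γ hΨ, mul_sum, smul_sum, mul_smul_comm, smul_smul, mul_assoc]
  have hswap : dslash n γ (dslash n γ Ψ) y =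
      ∑ a, ∑ b, (eta n a * eta n b) • (γ b * γ a * pd n a (pd n b Ψ) y) := by
    rw [hexp, sum_comm]
    refine sum_congr rfl fun a _ => sum_congr rfl fun b _ => ?_
    rw [pd_comm hΨ b a, mul_comm (eta n b)]
  have htwo : (2 : ℝ) • dslash n γ (dslash n γ Ψ) y = (2 : ℝ) • box n Ψ y := by
    rw [two_smul]
    nth_rewrite 1 [hexp]
    rw [hswap, ← sum_add_distrib, _root_.box, smul_sum]
    refine sum_congr rfl fun a _ => ?_
    rw [← sum_add_distrib]
    simp only [← smul_add, ← add_mul, hγ, smul_mul_assoc, one_mul, smul_smul]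
    rw [sum_eq_single a]
    · rw [if_pos rfl, eta_mul_self, one_mul]
    · intro b _ hb
      simp [hb.symm]
    · simp
  exact smul_right_injective A (two_ne_zero : (2 : ℝ) ≠ 0) htwo

theorem gamma_mul_self {γ : Fin (n + 2) → A}
    (hγ : ∀ a b, γ a * γ b + γ b * γ a
      = ((2 : ℝ) * (if a = b then eta n a else 0)) • (1 : A)) (a : Fin (n + 2)) :
    γ a * γ a = eta n a • (1 : A) := by
  have h := hγ a a
  rw [if_pos rfl, ← two_smul ℝ, mul_smul] at h
  exact smul_right_injective A (two_ne_zero : (2 : ℝ) ≠ 0) h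

theorem gamma_mul_yslash {γ : Fin (n + 2) → A}
    (hγ : ∀ a b, γ a * γ b + γ b * γ a
      = ((2 : ℝ) * (if a = b then eta n a else 0)) • (1 : A))
    (a : Fin (n + 2)) (y : Fin (n + 2) → ℝ) :
    γ a * ∑ b, y b • γ b = (2 * eta n a * y a) • (1 : A) - (∑ b, y b • γ b) * γ a := by
  rw [eq_sub_iff_add_eq, mul_sum, sum_mul, ← sum_add_distrib]
  simp only [mul_smul_comm, smul_mul_assoc, ← smul_add, hγ, smul_smul]
  rw [sum_eq_single a]
  · rw [if_pos rfl, mul_comm]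
  · intro b _ hb
    simp [hb.symm]
  · simp

/-- The relation `∂̸y̸ + y̸∂̸ = n + 2 + 2δ`. -/
theorem dslash_yslash {γ : Fin (n + 2) → A}
    (hγ : ∀ a b, γ a * γ b + γ b * γ a
      = ((2 : ℝ) * (if a = b then eta n a else 0)) • (1 : A))
    {Φ : (Fin (n + 2) → ℝ) → A} {y : Fin (n + 2) → ℝ} (hΦ : DifferentiableAt ℝ Φ y) :
    dslash n γ (yslash n γ Φ) y =
      ((n : ℝ) + 2) • Φ y + (2 : ℝ) • euler n Φ y - yslash n γ (dslash n γ Φ) y := by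
  have hcoord (b : Fin (n + 2)) : DifferentiableAt ℝ (fun z : Fin (n + 2) → ℝ => z b) y := by
    fun_prop
  have hpd (a : Fin (n + 2)) :
      pd n a (yslash n γ Φ) y = γ a * Φ y + (∑ b, y b • γ b) * pd n a Φ y := by
    have hy : yslash n γ Φ = fun z => ∑ b, z b • (γ b * Φ z) := by
      funext z
      simp only [yslash, sum_mul, smul_mul_assoc]
    rw [hy, pd_sum _ fun b _ => (hcoord b).fun_smul (hΦ.const_mul (γ b))]
    simp only [pd_coord_smul (hΦ.const_mul _), pd_const_mul hΦ, sum_add_distrib, sum_ite_eq',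
      mem_univ, if_true, sum_mul, smul_mul_assoc]
    rw [add_comm]
  have hterm (a : Fin (n + 2)) : eta n a • (γ a * pd n a (yslash n γ Φ) y) =
      Φ y + (2 : ℝ) • (y a • pd n a Φ y)
        - (∑ b, y b • γ b) * (eta n a • (γ a * pd n a Φ y)) := by
    rw [hpd, mul_add, ← mul_assoc, ← mul_assoc, gamma_mul_self hγ, gamma_mul_yslash hγ, sub_mul,
      smul_add, smul_sub, smul_mul_assoc, smul_mul_assoc, one_mul, one_mul, smul_smul, smul_smul,
      smul_smul, eta_mul_self, one_smul, mul_smul_comm, add_sub_assoc, mul_assoc (∑ b, y b • γ b)]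
    congr 3
    linear_combination (2 * y a) * eta_mul_self n a
  rw [dslash]
  simp only [hterm, sum_sub_distrib, sum_add_distrib, ← smul_sum, ← mul_sum]
  rw [sum_const, card_univ, Fintype.card_fin, ← Nat.cast_smul_eq_nsmul ℝ]
  push_cast
  rfl

end DiracOperator

/-- Item 4 of the Lemma on the properties of `y̸` and `∂̸`: on harmonic spinor
fields homogeneous of degree `-(E₀ + 1/2)` one has
`(y̸∂̸)² Ψ = (n - 1 - 2E₀)·(y̸∂̸)Ψ`; consequently, if `ε = E₀ - (n-1)/2 ≠ 0`,
the operator `(-2ε)⁻¹ y̸∂̸` acts idempotently on such `Ψ` (it is a projector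
onto an irreducible component of the tensor product decomposition). -/
theorem yslash_dslash_projector (n : ℕ) (hn : 2 ≤ n)
    (A : Type*) [NormedRing A] [NormedAlgebra ℝ A] [FiniteDimensional ℝ A]
    (γ : Fin (n + 2) → A)
    (hγ : ∀ a b, γ a * γ b + γ b * γ a
      = ((2 : ℝ) * (if a = b then eta n a else 0)) • (1 : A))
    (E₀ : ℝ)
    (Ψ : (Fin (n + 2) → ℝ) → A) (hΨ : ContDiff ℝ 2 Ψ)
    (hharm : ∀ y, box n Ψ y = 0)
    (hhom : ∀ y, euler n Ψ y = (-(E₀ + 1 / 2)) • Ψ y) :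
    (∀ y, yslash n γ (dslash n γ (fun z => yslash n γ (dslash n γ Ψ) z)) y
        = ((n : ℝ) - 1 - 2 * E₀) • yslash n γ (dslash n γ Ψ) y) ∧
    (E₀ - ((n : ℝ) - 1) / 2 ≠ 0 → ∀ y,
      (fun Φ : (Fin (n + 2) → ℝ) → A =>
          fun z => (-2 * (E₀ - ((n : ℝ) - 1) / 2))⁻¹ • yslash n γ (dslash n γ Φ) z)
        ((fun Φ : (Fin (n + 2) → ℝ) → A =>
          fun z => (-2 * (E₀ - ((n : ℝ) - 1) / 2))⁻¹ • yslash n γ (dslash n γ Φ) z) Ψ) y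
      = (-2 * (E₀ - ((n : ℝ) - 1) / 2))⁻¹ • yslash n γ (dslash n γ Ψ) y) := by
  have hΦ : Differentiable ℝ (dslash n γ Ψ) :=
    (contDiff_dslash γ hΨ).differentiable (by norm_num)
  have hsq (y : Fin (n + 2) → ℝ) :
      yslash n γ (dslash n γ (fun z => yslash n γ (dslash n γ Ψ) z)) y
        = ((n : ℝ) - 1 - 2 * E₀) • yslash n γ (dslash n γ Ψ) y := by
    have hdirac : dslash n γ (yslash n γ (dslash n γ Ψ)) y
        = ((n : ℝ) - 1 - 2 * E₀) • dslash n γ Ψ y := by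
      rw [dslash_yslash hγ (hΦ y), euler_dslash γ hΨ hhom, yslash, dslash_dslash hγ hΨ, hharm,
        mul_zero, sub_zero, smul_smul, ← add_smul]
      congr 1
      ring
    change (∑ a, y a • γ a) * dslash n γ (yslash n γ (dslash n γ Ψ)) y = _
    rw [hdirac, mul_smul_comm]
    rfl
  refine ⟨hsq, fun hε y => ?_⟩
  have hscale (c : ℝ) : yslash n γ (dslash n γ (fun z => c • yslash n γ (dslash n γ Ψ) z)) y
      = c • yslash n γ (dslash n γ (fun z => yslash n γ (dslash n γ Ψ) z)) y := by
    rw [yslash, dslash_const_smul γ (differentiable_yslash γ hΦ y), mul_smul_comm]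
    rfl
  have hcoef : (n : ℝ) - 1 - 2 * E₀ = -2 * (E₀ - ((n : ℝ) - 1) / 2) := by ring
  beta_reduce
  rw [hscale, hsq, hcoef, inv_smul_smul₀ (mul_ne_zero (by norm_num) hε)]
end
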